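/- arXiv:0904.1295 — 2 statements merged into one kernel-verified Lean document; each statement's English description precedes it below -/
import Mathlib

section
/- Let a < b be real numbers and let f : [a,b] → ℝ be continuously differentiable with f(a) = f(b) = 0. Then ∫_a^b f'(x)^2 dx ≥ (π^2/(b−a)^2) ∫_a^b f(x)^2 dx. -/
open MeasureTheory

lemma wirtinger_aux (a b : ℝ) (hab : a < b) (f f' : ℝ → ℝ)
    (hderiv : ∀ x ∈ Set.Icc a b, HasDerivWithinAt f (f' x) (Set.Icc a b) x)
    (hcont : ContinuousOn f' (Set.Icc a b))
    (ha : f a = 0) (hb : f b = 0) (k : ℝ) (hk0 : 0 < k) (hk : k < Real.pi / (b - a)) :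
    k ^ 2 * ∫ x in a..b, f x ^ 2 ≤ ∫ x in a..b, f' x ^ 2 := by
  have hba : 0 < b - a := sub_pos.2 hab
  have hkb : k * (b - a) < Real.pi := (lt_div_iff₀ hba).1 hk
  have hcos : ∀ x ∈ Set.Icc a b, 0 < Real.cos (k * (x - (a + b) / 2)) := by
    intro x hx
    apply Real.cos_pos_of_mem_Ioo
    constructor <;> nlinarith [hx.1, hx.2]
  have hf : ContinuousOn f (Set.Icc a b) := fun x hx => (hderiv x hx).continuousWithinAt
  set g : ℝ → ℝ := fun x => -k * Real.tan (k * (x - (a + b) / 2)) with hg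
  have hgd : ∀ x ∈ Set.Icc a b, HasDerivAt g (-k ^ 2 - g x ^ 2) x := by
    intro x hx
    have hc := hcos x hx
    have h1 : HasDerivAt (fun x : ℝ => k * (x - (a + b) / 2)) (k * 1) x :=
      ((hasDerivAt_id x).sub_const _).const_mul k
    have h2 := ((Real.hasDerivAt_tan hc.ne').comp x h1).const_mul (-k)
    refine HasDerivAt.congr_deriv (f := g) h2 ?_
    simp only [hg, Real.tan_eq_sin_div_cos]
    have := Real.sin_sq_add_cos_sq (k * (x - (a + b) / 2))
    clear h2 h1
    generalize k * (x - (a + b) / 2) = y at *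
    have hc' := hc.ne'
    field_simp
    linarith
  have hgc : ContinuousOn g (Set.Icc a b) := fun x hx => (hgd x hx).continuousAt.continuousWithinAt
  have hI : ∀ h : ℝ → ℝ, ContinuousOn h (Set.Icc a b) → IntervalIntegrable h volume a b := by
    intro h hh
    exact ContinuousOn.intervalIntegrable_of_Icc hab.le hh
  have hW := intervalIntegral.integral_eq_sub_of_hasDerivAt_of_le (a := a) (b := b)
    (f := fun x => f x ^ 2 * g x)
    (f' := fun x => 2 * f x * f' x * g x + f x ^ 2 * (-k ^ 2 - g x ^ 2)) hab.le
    (by fun_prop)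
    (by
      intro x hx
      have hx' := Set.Ioo_subset_Icc_self hx
      have h1 := (hderiv x hx').hasDerivAt (Icc_mem_nhds hx.1 hx.2)
      refine HasDerivAt.congr_deriv (f := fun x => f x ^ 2 * g x) ((h1.pow 2).mul (hgd x hx')) ?_
      simp)
    (hI _ (by fun_prop))
  simp only [ha, hb] at hW
  have hsq : 0 ≤ ∫ x in a..b, (f' x - f x * g x) ^ 2 :=
    intervalIntegral.integral_nonneg hab.le fun x _ => sq_nonneg _
  have e : ∫ x in a..b, (f' x - f x * g x) ^ 2 =
      ∫ x in a..b, ((f' x ^ 2 - k ^ 2 * f x ^ 2) -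
        (2 * f x * f' x * g x + f x ^ 2 * (-k ^ 2 - g x ^ 2))) := by
    congr 1; ext x; ring
  rw [e, intervalIntegral.integral_sub (hI _ (by fun_prop)) (hI _ (by fun_prop)), hW,
    intervalIntegral.integral_sub (hI _ (by fun_prop)) (hI _ (by fun_prop)),
    intervalIntegral.integral_const_mul] at hsq
  linarith

/-- Wirtinger's inequality with Dirichlet boundary conditions. -/
theorem wirtinger_inequality (a b : ℝ) (hab : a < b) (f f' : ℝ → ℝ)
    (hderiv : ∀ x ∈ Set.Icc a b, HasDerivWithinAt f (f' x) (Set.Icc a b) x)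
    (hcont : ContinuousOn f' (Set.Icc a b))
    (ha : f a = 0) (hb : f b = 0) :
    Real.pi ^ 2 / (b - a) ^ 2 * ∫ x in a..b, f x ^ 2 ≤ ∫ x in a..b, f' x ^ 2 := by
  have hc : 0 < Real.pi / (b - a) := div_pos Real.pi_pos (sub_pos.2 hab)
  rw [← div_pow]
  have ht : Filter.Tendsto (fun k : ℝ => k ^ 2 * ∫ x in a..b, f x ^ 2)
      (nhdsWithin (Real.pi / (b - a)) (Set.Iio (Real.pi / (b - a))))
      (nhds ((Real.pi / (b - a)) ^ 2 * ∫ x in a..b, f x ^ 2)) := by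
    apply Filter.Tendsto.mono_left _ nhdsWithin_le_nhds
    exact Continuous.tendsto (by fun_prop) _
  refine le_of_tendsto ht ?_
  filter_upwards [Ioo_mem_nhdsLT hc] with k hk
  exact wirtinger_aux a b hab f f' hderiv hcont ha hb k hk.1 hk.2
end

section
/- Let β ∈ (0,1/e), let ξ > e satisfy e^{βξ} = ξ and μ = βξ > 1, and let Φ : (ξ,∞) → (0,∞) be an increasing function satisfying Φ(e^{βx}) = μ Φ(x) for all x > ξ. Then Φ(x) → ∞ as x → ∞, and for every m ∈ ℕ one has lim_{x→∞} Φ(x)/log^m(x) = 0, where log^m denotes the m-th iterate of the logarithm. Consequently ε(x) = 1/Φ(x) is decreasing, tends to 0 as x → ∞, but tends to 0 slower than each of the functions 1/log^m(x). -/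
open Filter Topology

lemma logIter_mono_ev (m : ℕ) : ∃ K : ℝ, ∀ u v : ℝ, K ≤ u → u ≤ v →
    1 ≤ Real.log^[m] u ∧ Real.log^[m] u ≤ Real.log^[m] v := by
  induction m with
  | zero => exact ⟨1, fun u v h1 h2 => ⟨h1, h2⟩⟩
  | succ m ih =>
    obtain ⟨K, hK⟩ := ih
    refine ⟨Real.exp K, fun u v h1 h2 => ?_⟩
    have hu : 0 < u := lt_of_lt_of_le (Real.exp_pos _) h1
    simp only [Function.iterate_succ, Function.comp]
    exact hK _ _ ((Real.le_log_iff_exp_le hu).2 h1) (Real.log_le_log hu h2)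

/-- Growth of solutions of Schröder's equation: `Φ → ∞` but slower than any
iterated logarithm; consequently `ε = 1/Φ` decreases to `0` slower than
`1/log^m`. -/
theorem schroeder_solution_growth (β ξ μ : ℝ)
    (hβ : β ∈ Set.Ioo 0 (1 / Real.exp 1))
    (hξ : Real.exp 1 < ξ) (hfix : Real.exp (β * ξ) = ξ)
    (hμ : μ = β * ξ) (hμ1 : 1 < μ)
    (Φ : ℝ → ℝ) (hΦpos : ∀ x, ξ < x → 0 < Φ x)
    (hΦmono : StrictMonoOn Φ (Set.Ioi ξ))
    (hSchroeder : ∀ x, ξ < x → Φ (Real.exp (β * x)) = μ * Φ x) :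
    Tendsto Φ atTop atTop ∧
    (∀ m : ℕ, Tendsto (fun x => Φ x / Real.log^[m] x) atTop (nhds 0)) ∧
    StrictAntiOn (fun x => 1 / Φ x) (Set.Ioi ξ) ∧
    Tendsto (fun x => 1 / Φ x) atTop (nhds 0) ∧
    ∀ m : ℕ, Tendsto (fun x => (1 / Real.log^[m] x) / (1 / Φ x)) atTop (nhds 0) := by
  obtain ⟨hβ0, -⟩ := hβ
  have hξ1 : 1 < ξ := by
    have := Real.add_one_lt_exp (x := 1) (by norm_num)
    linarith
  have hE : ∀ x, ξ + μ * (x - ξ) ≤ Real.exp (β * x) := by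
    intro x
    have h1 : Real.exp (β * x) = ξ * Real.exp (β * (x - ξ)) := by
      have h0 : β * x = β * ξ + β * (x - ξ) := by ring
      rw [h0, Real.exp_add, hfix]
    have h2 := Real.add_one_le_exp (β * (x - ξ))
    rw [h1, hμ]
    nlinarith
  -- orbit
  have horb : ∀ X, ξ < X → ∀ n : ℕ, ξ + μ ^ n * (X - ξ) ≤ (fun x => Real.exp (β * x))^[n] X := by
    intro X hX n
    induction n with
    | zero => simp
    | succ n ih =>
      rw [Function.iterate_succ_apply']
      refine le_trans ?_ (hE _)
      rw [pow_succ]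
      nlinarith
  have horb' : ∀ X, ξ < X → ∀ n : ℕ, ξ < (fun x => Real.exp (β * x))^[n] X := by
    intro X hX n
    refine lt_of_lt_of_le ?_ (horb X hX n)
    have : 0 < μ ^ n * (X - ξ) := mul_pos (pow_pos (by linarith) _) (by linarith)
    linarith
  have hΦorb : ∀ X, ξ < X → ∀ n : ℕ, Φ ((fun x => Real.exp (β * x))^[n] X) = μ ^ n * Φ X := by
    intro X hX n
    induction n with
    | zero => simp
    | succ n ih =>
      rw [Function.iterate_succ_apply', hSchroeder _ (horb' X hX n), ih, pow_succ]; ring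
  have hpow : Tendsto (fun n : ℕ => μ ^ n) atTop atTop := tendsto_pow_atTop_atTop_of_one_lt hμ1
  have hL : ∀ x, ξ < x → ξ < Real.log x / β := by
    intro x hx
    rw [lt_div_iff₀ hβ0, Real.lt_log_iff_exp_lt (by linarith), mul_comm, hfix]
    exact hx
  have hEL : ∀ x, ξ < x → Real.exp (β * (Real.log x / β)) = x := by
    intro x hx
    rw [mul_div_cancel₀ _ hβ0.ne', Real.exp_log (by linarith)]
  have hSL : ∀ x, ξ < x → Φ x = μ * Φ (Real.log x / β) := by
    intro x hx
    rw [← hSchroeder _ (hL x hx), hEL x hx]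
  have hLtop : Tendsto (fun x => Real.log x / β) atTop atTop :=
    Real.tendsto_log_atTop.atTop_div_const hβ0
  have hLo : Tendsto (fun x => Real.log x / x) atTop (nhds 0) := by
    have := Real.isLittleO_log_id_atTop.tendsto_div_nhds_zero
    simpa using this
  have A : Tendsto Φ atTop atTop := by
    rw [tendsto_atTop]
    intro C
    have hX : ξ < ξ + 1 := by linarith
    have := hpow.atTop_mul_const (hΦpos _ hX)
    obtain ⟨n, hn⟩ := (this.eventually_ge_atTop C).exists
    filter_upwards [eventually_ge_atTop ((fun x => Real.exp (β * x))^[n] (ξ + 1))] with x hx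
    rw [← hΦorb _ hX] at hn
    have h1 := horb' _ hX n
    exact hn.trans (hΦmono.monotoneOn h1 (lt_of_lt_of_le h1 hx) hx)
  -- linear bound
  have hlin : ∃ M : ℝ, ∀ x, ξ < x → Φ x ≤ M * x := by
    have hc : Tendsto (fun x => (μ / β) * (Real.log x / x)) atTop (nhds 0) := by
      simpa using hLo.const_mul (μ / β)
    obtain ⟨X, hX⟩ := eventually_atTop.1 ((hc.eventually_le_const one_pos).and
      (eventually_gt_atTop ξ))
    have hXξ : ξ < X := (hX X le_rfl).2
    have hM := hΦpos X hXξ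
    have key : ∀ n : ℕ, ∀ x, ξ < x → x ≤ (fun x => Real.exp (β * x))^[n] X → Φ x ≤ Φ X * x := by
      have base : ∀ x, ξ < x → x ≤ X → Φ x ≤ Φ X * x := by
        intro x h1 h2
        have := hΦmono.monotoneOn h1 hXξ h2
        nlinarith
      intro n
      induction n with
      | zero => exact base
      | succ n ih =>
        intro x h1 h2
        rcases le_total x X with h | h
        · exact base x h1 h
        · rw [Function.iterate_succ_apply'] at h2
          have h3 : Real.log x / β ≤ (fun x => Real.exp (β * x))^[n] X := by
            rw [div_le_iff₀ hβ0, Real.log_le_iff_le_exp (by linarith), mul_comm]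
            exact h2
          have h4 := ih _ (hL x h1) h3
          have h5 := (hX x h).1
          have hx0 : 0 < x := by linarith
          have h6 : μ * (Real.log x / β) ≤ x := by
            have : (μ / β) * (Real.log x / x) = μ * (Real.log x / β) / x := by ring
            rw [this, div_le_one hx0] at h5
            exact h5
          rw [hSL x h1]
          calc μ * Φ (Real.log x / β) ≤ μ * (Φ X * (Real.log x / β)) := by gcongr
            _ = Φ X * (μ * (Real.log x / β)) := by ring
            _ ≤ Φ X * x := by gcongr
    refine ⟨Φ X, fun x hx => ?_⟩
    have h7 := hpow.atTop_mul_const (sub_pos.2 hXξ)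
    obtain ⟨n, hn⟩ := (h7.eventually_ge_atTop x).exists
    exact key n x hx (by have := horb X hXξ n; linarith)
  have P : ∀ m : ℕ, ∀ a : ℝ, 0 < a → Tendsto (fun x => Φ x / Real.log^[m] (a * x)) atTop (nhds 0) := by
    intro m
    induction m with
    | zero =>
      intro a ha
      obtain ⟨M, hM⟩ := hlin
      have hc : Tendsto (fun x => (μ * M / β / a) * (Real.log x / x)) atTop (nhds 0) := by
        simpa using hLo.const_mul (μ * M / β / a)
      refine squeeze_zero' ?_ ?_ hc
      · filter_upwards [eventually_gt_atTop ξ] with x hx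
        have := hΦpos x hx
        have hx0 : 0 < x := by linarith
        simp only [Function.iterate_zero, id]
        positivity
      · filter_upwards [eventually_gt_atTop ξ] with x hx
        have hx0 : 0 < x := by linarith
        simp only [Function.iterate_zero, id]
        have h1 := hM _ (hL x hx)
        rw [hSL x hx]
        have : (μ * M / β / a) * (Real.log x / x) = μ * (M * (Real.log x / β)) / (a * x) := by
          field_simp
        rw [this]
        gcongr
    | succ m ih =>
      intro a ha
      obtain ⟨K, hK⟩ := logIter_mono_ev m
      have hc : Tendsto (fun x => μ * (Φ (Real.log x / β) / Real.log^[m] (β / 2 * (Real.log x / β))))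
          atTop (nhds 0) := by
        simpa using ((ih (β / 2) (by positivity)).comp hLtop).const_mul μ
      have hev : ∀ᶠ x in atTop, ξ < x ∧ 1 ≤ Real.log^[m] (β / 2 * (Real.log x / β)) ∧
          Real.log^[m] (β / 2 * (Real.log x / β)) ≤ Real.log^[m + 1] (a * x) := by
        filter_upwards [eventually_gt_atTop ξ,
          Real.tendsto_log_atTop.eventually_ge_atTop (2 * K),
          Real.tendsto_log_atTop.eventually_ge_atTop (-2 * Real.log a)] with x h1 h2 h3
        have e : β / 2 * (Real.log x / β) = Real.log x / 2 := by field_simp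
        rw [e, Function.iterate_succ_apply, Real.log_mul ha.ne' (by linarith)]
        exact ⟨h1, hK _ _ (by linarith) (by linarith)⟩
      refine squeeze_zero' ?_ ?_ hc
      · filter_upwards [hev] with x hx
        exact div_nonneg (hΦpos x hx.1).le (by linarith [hx.2.1, hx.2.2])
      · filter_upwards [hev] with x hx
        obtain ⟨h1, h2, h3⟩ := hx
        have := hΦpos _ (hL x h1)
        rw [hSL x h1, mul_div_assoc]
        gcongr
  have P1 : ∀ m : ℕ, Tendsto (fun x => Φ x / Real.log^[m] x) atTop (nhds 0) := by
    intro m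
    simpa using P m 1 one_pos
  refine ⟨A, P1, ?_, ?_, ?_⟩
  · intro x hx y hy hxy
    exact one_div_lt_one_div_of_lt (hΦpos x hx) (hΦmono hx hy hxy)
  · refine A.inv_tendsto_atTop.congr fun x => ?_
    simp
  · intro m
    refine (P1 m).congr fun x => ?_
    simp [div_eq_mul_inv, mul_comm]
end
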